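/- For n ≥ 0 define the bivariate polynomial R_n(x,y) = Σ_{π ∈ S_n(1-3-2)} x^{e_2(π)} y^{e_3(π)} (with R_0 = 1). Then for all n ≥ 0, R_{n+1}(x,y) = R_n(x,y) + x · Σ_{a+b=n, a≥1} R_a(xy, y)·R_b(x,y), where R_a(xy,y) denotes the polynomial R_a with x replaced by the product xy. -/

import Mathlib

/-- An occurrence of the classical pattern 1-3-2 in a sequence `w` of distinct
integers is a triple of indices `i < j < k` with `w i < w k < w j`;
`w` avoids 1-3-2 if it has no such occurrence. -/
def Avoids132 {m : ℕ} (w : Fin m → ℤ) : Prop :=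
  ∀ i j k : Fin m, i < j → j < k → ¬(w i < w k ∧ w k < w j)

/-- `π : Fin n → ℤ` is a permutation of length `n`, i.e. a sequence containing
each of the integers `1,…,n` exactly once. -/
def IsPermSeq (n : ℕ) (π : Fin n → ℤ) : Prop :=
  Function.Injective π ∧ ∀ i, 1 ≤ π i ∧ π i ≤ (n : ℤ)

/-- The prefix `π' = (π_1, …, π_{j-1})` of `π` strictly before position `j`. -/
def leftPart {n : ℕ} (π : Fin n → ℤ) (j : Fin n) : Fin (j : ℕ) → ℤ :=
  fun a => π ⟨(a : ℕ), lt_trans a.isLt j.isLt⟩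

/-- The suffix `π'' = (π_{j+1}, …, π_n)` of `π` strictly after position `j`. -/
def rightPart {n : ℕ} (π : Fin n → ℤ) (j : Fin n) : Fin (n - (j : ℕ) - 1) → ℤ :=
  fun a => π ⟨(j : ℕ) + 1 + (a : ℕ), by have h1 := a.isLt; have h2 := j.isLt; omega⟩

/-- An occurrence of the generalized pattern `12-3-…-k` in `w`:
indices `i 0 < i 1 < ⋯ < i (k-1)` with `i 1 = i 0 + 1` and
`w (i 0) < w (i 1) < ⋯ < w (i (k-1))`. -/
def Occ12 {m : ℕ} (k : ℕ) (w : Fin m → ℤ) (i : Fin k → Fin m) : Prop :=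
  StrictMono i ∧ StrictMono (w ∘ i) ∧
    ∀ a b : Fin k, (a : ℕ) = 0 → (b : ℕ) = 1 → (i b : ℕ) = (i a : ℕ) + 1

/-- The relative order of the letters of the pattern `21-3-…-k`. -/
def fPat (j : ℕ) : ℕ := if j = 0 then 1 else if j = 1 then 0 else j

/-- An occurrence of the generalized pattern `21-3-…-k` in `w`:
indices `i 0 < i 1 < ⋯ < i (k-1)` with `i 1 = i 0 + 1` and
`w (i 1) < w (i 0) < w (i 2) < ⋯ < w (i (k-1))`. -/
def Occ21 {m : ℕ} (k : ℕ) (w : Fin m → ℤ) (i : Fin k → Fin m) : Prop :=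
  StrictMono i ∧ (∀ a b : Fin k, fPat (a : ℕ) < fPat (b : ℕ) ↔ w (i a) < w (i b)) ∧
    ∀ a b : Fin k, (a : ℕ) = 0 → (b : ℕ) = 1 → (i b : ℕ) = (i a : ℕ) + 1

/-- `eStat k w` is the number of occurrences of the generalized pattern
`12-3-…-k` in `w` (for `k = 2` this is the number of ascents). -/
noncomputable def eStat (k : ℕ) {m : ℕ} (w : Fin m → ℤ) : ℕ :=
  Nat.card {i : Fin k → Fin m // Occ12 k w i}

/-- `fStat k w` is the number of occurrences of the generalized pattern
`21-3-…-k` in `w` (for `k = 2` this is the number of descents). -/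
noncomputable def fStat (k : ℕ) {m : ℕ} (w : Fin m → ℤ) : ℕ :=
  Nat.card {i : Fin k → Fin m // Occ21 k w i}

/-- The number of ascents of `w`: indices `i` with `w i < w (i+1)`. -/
noncomputable def asc {m : ℕ} (w : Fin m → ℤ) : ℕ :=
  Nat.card {p : Fin m × Fin m // (p.2 : ℕ) = (p.1 : ℕ) + 1 ∧ w p.1 < w p.2}

/-- The number of descents of `w`: indices `i` with `w i > w (i+1)`. -/
noncomputable def des {m : ℕ} (w : Fin m → ℤ) : ℕ :=
  Nat.card {p : Fin m × Fin m // (p.2 : ℕ) = (p.1 : ℕ) + 1 ∧ w p.2 < w p.1}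

/-- `totE w = Σ_{k ≥ 2} e_k(w)`: the total number of 2-increasing
subsequences of `w`. -/
noncomputable def totE {m : ℕ} (w : Fin m → ℤ) : ℕ :=
  Nat.card ((k : ℕ) × {i : Fin k → Fin m // 2 ≤ k ∧ Occ12 k w i})

/-- `totF w = Σ_{k ≥ 2} f_k(w)`: the total number of almost 2-increasing
subsequences of `w`. -/
noncomputable def totF {m : ℕ} (w : Fin m → ℤ) : ℕ :=
  Nat.card ((k : ℕ) × {i : Fin k → Fin m // 2 ≤ k ∧ Occ21 k w i})

/-- The extension by zero of a finite sequence to a sequence indexed by `ℕ`. -/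
def extendSeq {m : ℕ} (w : Fin m → ℤ) (i : ℕ) : ℤ :=
  if h : i < m then w ⟨i, h⟩ else 0

theorem extendSeq_of_lt {m : ℕ} (w : Fin m → ℤ) {i : ℕ} (h : i < m) :
    extendSeq w i = w ⟨i, h⟩ := dif_pos h

@[simp] theorem extendSeq_val {m : ℕ} (w : Fin m → ℤ) (i : Fin m) :
    extendSeq w i = w i := dif_pos i.isLt

theorem eq_of_extendSeq_eq {m : ℕ} {v w : Fin m → ℤ}
    (h : ∀ i < m, extendSeq v i = extendSeq w i) : v = w := by
  funext i
  simpa using h i i.isLt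

/-- The number of ascents among the first `m` entries of `W`. -/
def ascCount (m : ℕ) (W : ℕ → ℤ) : ℕ :=
  ∑ i ∈ Finset.range m, ∑ j ∈ Finset.range m, if j = i + 1 ∧ W i < W j then 1 else 0

/-- The number of occurrences of `12-3` among the first `m` entries of `W`. -/
def ascThenCount (m : ℕ) (W : ℕ → ℤ) : ℕ :=
  ∑ i ∈ Finset.range m, ∑ k ∈ Finset.range m,
    if i + 1 < k ∧ W i < W (i + 1) ∧ W (i + 1) < W k then 1 else 0

theorem eStat_two {m : ℕ} (w : Fin m → ℤ) : eStat 2 w = ascCount m (extendSeq w) := by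
  classical
  rw [eStat, Nat.card_eq_fintype_card, Fintype.card_subtype, ascCount, ← Finset.sum_product',
    Finset.sum_boole, Nat.cast_id]
  refine Finset.card_bij (fun f _ => ((f 0 : ℕ), (f 1 : ℕ))) ?_ ?_ ?_
  · intro f hf
    obtain ⟨-, h2, h3⟩ := (Finset.mem_filter.1 hf).2
    have := h2 (show (0 : Fin 2) < 1 by decide)
    simpa using ⟨h3 0 1 rfl rfl, this⟩
  · intro f _ g _ h
    simp only [Prod.mk.injEq] at h
    funext x
    fin_cases x
    · exact Fin.ext h.1
    · exact Fin.ext h.2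
  · rintro ⟨i, j⟩ h
    simp only [Finset.mem_filter, Finset.mem_product, Finset.mem_range] at h
    obtain ⟨⟨hi, hj⟩, hij, hw⟩ := h
    rw [extendSeq_of_lt w hi, extendSeq_of_lt w hj] at hw
    refine ⟨![⟨i, hi⟩, ⟨j, hj⟩], ?_, by simp⟩
    refine Finset.mem_filter.2 ⟨Finset.mem_univ _, ?_, ?_, ?_⟩
    · rw [Fin.strictMono_iff_lt_succ]
      intro x
      fin_cases x
      simp; omega
    · rw [Fin.strictMono_iff_lt_succ]
      intro x
      fin_cases x
      simpa using hw
    · intro x y hx hy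
      obtain rfl : x = 0 := Fin.ext hx
      obtain rfl : y = 1 := Fin.ext hy
      simpa using hij

theorem eStat_three {m : ℕ} (w : Fin m → ℤ) : eStat 3 w = ascThenCount m (extendSeq w) := by
  classical
  rw [eStat, Nat.card_eq_fintype_card, Fintype.card_subtype, ascThenCount,
    ← Finset.sum_product', Finset.sum_boole, Nat.cast_id]
  refine Finset.card_bij (fun f _ => ((f 0 : ℕ), (f 2 : ℕ))) ?_ ?_ ?_
  · intro f hf
    obtain ⟨h1, h2, h3⟩ := (Finset.mem_filter.1 hf).2
    have a1 := h2 (show (0 : Fin 3) < 1 by decide)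
    have a2 := h2 (show (1 : Fin 3) < 2 by decide)
    have a3 : (f 1 : ℕ) < f 2 := h1 (show (1 : Fin 3) < 2 by decide)
    have a4 := h3 0 1 rfl rfl
    simp only [Finset.mem_filter, Finset.mem_product, Finset.mem_range, Fin.is_lt, true_and,
      ← a4, extendSeq_val]
    exact ⟨a3, a1, a2⟩
  · intro f hf g hg h
    have a4 := (Finset.mem_filter.1 hf).2.2.2 0 1 rfl rfl
    have a5 := (Finset.mem_filter.1 hg).2.2.2 0 1 rfl rfl
    simp only [Prod.mk.injEq] at h
    funext x
    fin_cases x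
    · exact Fin.ext h.1
    · refine Fin.ext ?_
      change (f 1 : ℕ) = g 1
      omega
    · exact Fin.ext h.2
  · rintro ⟨i, k⟩ h
    simp only [Finset.mem_filter, Finset.mem_product, Finset.mem_range] at h
    obtain ⟨⟨hi, hk⟩, hik, hw, hw'⟩ := h
    have hj : i + 1 < m := by omega
    rw [extendSeq_of_lt w hi, extendSeq_of_lt w hj] at hw
    rw [extendSeq_of_lt w hj, extendSeq_of_lt w hk] at hw'
    refine ⟨![⟨i, hi⟩, ⟨i + 1, hj⟩, ⟨k, hk⟩], ?_, by simp⟩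
    refine Finset.mem_filter.2 ⟨Finset.mem_univ _, ?_, ?_, ?_⟩
    · rw [Fin.strictMono_iff_lt_succ]
      intro x
      fin_cases x
      · simp
      · simpa using hik
    · rw [Fin.strictMono_iff_lt_succ]
      intro x
      fin_cases x
      · simpa using hw
      · simpa using hw'
    · intro x y hx hy
      obtain rfl : x = 0 := Fin.ext hx
      obtain rfl : y = 1 := Fin.ext hy
      simp

theorem sum_range_add_one_add (f : ℕ → ℕ) (a b : ℕ) :
    ∑ i ∈ Finset.range (a + 1 + b), f i =
      ∑ i ∈ Finset.range a, f i + f a + ∑ i ∈ Finset.range b, f (a + 1 + i) := by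
  rw [Finset.sum_range_add, Finset.sum_range_succ]

/-- The first `a + 1 + b` entries of `W` are a shifted copy of `U` of length `a`, a maximum, and
a copy of `V` of length `b` lying below the copy of `U`. -/
structure IsGluing (a b : ℕ) (c : ℤ) (U V W : ℕ → ℤ) : Prop where
  left : ∀ i < a, W i = U i + c
  right : ∀ j < b, W (a + 1 + j) = V j
  left_lt : ∀ i < a, W i < W a
  right_lt : ∀ j < b, W (a + 1 + j) < W a
  right_lt_left : ∀ i < a, ∀ j < b, W (a + 1 + j) < W i

theorem IsGluing.ascCount_eq {a b : ℕ} {c : ℤ} {U V W : ℕ → ℤ} (h : IsGluing a b c U V W) :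
    ascCount (a + 1 + b) W = (if 1 ≤ a then 1 else 0) + ascCount a U + ascCount b V := by
  have hLL : ∀ i ∈ Finset.range a, (∑ j ∈ Finset.range (a + 1 + b),
      if j = i + 1 ∧ W i < W j then 1 else 0) =
      (∑ j ∈ Finset.range a, if j = i + 1 ∧ U i < U j then 1 else 0) +
        if a = i + 1 then 1 else 0 := by
    intro i hi
    rw [Finset.mem_range] at hi
    rw [sum_range_add_one_add, Finset.sum_eq_zero (s := Finset.range b), add_zero]
    · congr 1
      · refine Finset.sum_congr rfl fun j hj => ?_
        rw [Finset.mem_range] at hj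
        simp [h.left i hi, h.left j hj]
      · simp [h.left_lt i hi]
    · intro j _
      rw [if_neg]
      omega
  have hM : (∑ j ∈ Finset.range (a + 1 + b), if j = a + 1 ∧ W a < W j then 1 else 0) = 0 := by
    refine Finset.sum_eq_zero fun j hj => if_neg ?_
    rintro ⟨rfl, hlt⟩
    have hj' : 0 < b := by simpa using hj
    exact lt_asymm hlt (h.right_lt 0 hj')
  have hRR : ∀ i ∈ Finset.range b, (∑ j ∈ Finset.range (a + 1 + b),
      if j = a + 1 + i + 1 ∧ W (a + 1 + i) < W j then 1 else 0) =
      ∑ j ∈ Finset.range b, if j = i + 1 ∧ V i < V j then 1 else 0 := by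
    intro i hi
    rw [Finset.mem_range] at hi
    rw [sum_range_add_one_add, Finset.sum_eq_zero (s := Finset.range a), if_neg (by omega),
      zero_add, zero_add]
    · refine Finset.sum_congr rfl fun j hj => ?_
      rw [Finset.mem_range] at hj
      have hij : a + 1 + j = a + 1 + i + 1 ↔ j = i + 1 := by omega
      simp only [h.right i hi, h.right j hj, hij]
    · intro j hj
      rw [Finset.mem_range] at hj
      rw [if_neg]
      omega
  have hI : (∑ i ∈ Finset.range a, if a = i + 1 then 1 else 0) = if 1 ≤ a then 1 else 0 := by
    cases a with
    | zero => simp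
    | succ a => simp
  rw [ascCount, sum_range_add_one_add, Finset.sum_congr rfl hLL, hM, Finset.sum_congr rfl hRR,
    Finset.sum_add_distrib, hI, ascCount, ascCount]
  ring

theorem IsGluing.ascThenCount_eq {a b : ℕ} {c : ℤ} {U V W : ℕ → ℤ}
    (h : IsGluing a b c U V W) :
    ascThenCount (a + 1 + b) W = ascThenCount a U + ascCount a U + ascThenCount b V := by
  have hLL : ∀ i ∈ Finset.range a, (∑ k ∈ Finset.range (a + 1 + b),
      if i + 1 < k ∧ W i < W (i + 1) ∧ W (i + 1) < W k then 1 else 0) =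
      (∑ k ∈ Finset.range a, if i + 1 < k ∧ U i < U (i + 1) ∧ U (i + 1) < U k then 1 else 0) +
        ∑ j ∈ Finset.range a, if j = i + 1 ∧ U i < U j then 1 else 0 := by
    intro i hi
    rw [Finset.mem_range] at hi
    rw [sum_range_add_one_add, Finset.sum_eq_zero (s := Finset.range b), add_zero]
    · congr 1
      · refine Finset.sum_congr rfl fun k hk => ?_
        rw [Finset.mem_range] at hk
        by_cases hik : i + 1 < k
        · simp [h.left i hi, h.left k hk, h.left (i + 1) (by omega)]
        · simp [hik]
      · by_cases hia : i + 1 < a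
        · rw [Finset.sum_eq_single_of_mem (i + 1) (Finset.mem_range.2 hia) fun j _ hj =>
            if_neg fun hc => hj hc.1]
          have hlt := h.left_lt (i + 1) hia
          rw [h.left (i + 1) hia] at hlt
          simp only [hia, hlt, true_and, and_true, h.left i hi, h.left (i + 1) hia,
            add_lt_add_iff_right]
        · rw [if_neg (by tauto), Finset.sum_eq_zero]
          intro j hj
          rw [Finset.mem_range] at hj
          rw [if_neg]
          omega
    · intro j hj
      rw [Finset.mem_range] at hj
      refine if_neg fun hc => ?_
      have := h.right_lt_left i hi j hj
      omega
  have hM : (∑ k ∈ Finset.range (a + 1 + b),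
      if a + 1 < k ∧ W a < W (a + 1) ∧ W (a + 1) < W k then 1 else 0) = 0 := by
    refine Finset.sum_eq_zero fun k hk => if_neg fun hc => ?_
    rw [Finset.mem_range] at hk
    exact lt_asymm hc.2.1 (h.right_lt 0 (by omega))
  have hRR : ∀ i ∈ Finset.range b, (∑ k ∈ Finset.range (a + 1 + b),
      if a + 1 + i + 1 < k ∧ W (a + 1 + i) < W (a + 1 + i + 1) ∧ W (a + 1 + i + 1) < W k
        then 1 else 0) =
      ∑ k ∈ Finset.range b, if i + 1 < k ∧ V i < V (i + 1) ∧ V (i + 1) < V k then 1 else 0 := by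
    intro i hi
    rw [Finset.mem_range] at hi
    rw [sum_range_add_one_add, Finset.sum_eq_zero (s := Finset.range a), if_neg (by omega),
      zero_add, zero_add]
    · refine Finset.sum_congr rfl fun k hk => ?_
      rw [Finset.mem_range] at hk
      have hlt : a + 1 + i + 1 < a + 1 + k ↔ i + 1 < k := by omega
      simp only [hlt]
      by_cases hik : i + 1 < k
      · have := h.right (i + 1) (by omega)
        rw [← add_assoc] at this
        simp [h.right i hi, h.right k hk, this]
      · simp [hik]
    · intro j hj
      rw [Finset.mem_range] at hj
      rw [if_neg]
      omega
  rw [ascThenCount, sum_range_add_one_add, Finset.sum_congr rfl hLL, hM,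
    Finset.sum_congr rfl hRR, Finset.sum_add_distrib, ascCount, ascThenCount, ascThenCount]
  ring

open Classical in
/-- The finite set of permutations of length `n` avoiding 1-3-2. -/
noncomputable def perms132 (n : ℕ) : Finset (Fin n → ℤ) :=
  (Fintype.piFinset fun _ => Finset.Icc (1 : ℤ) n).filter
    fun π => IsPermSeq n π ∧ Avoids132 π

theorem mem_perms132 {n : ℕ} {π : Fin n → ℤ} :
    π ∈ perms132 n ↔ IsPermSeq n π ∧ Avoids132 π := by
  simp only [perms132, Finset.mem_filter, Fintype.mem_piFinset, Finset.mem_Icc]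
  exact ⟨fun h => h.2, fun h => ⟨h.1.2, h⟩⟩

theorem mem_perms132_iff_extendSeq {n : ℕ} {π : Fin n → ℤ} :
    π ∈ perms132 n ↔
      (∀ i j, i < j → j < n → extendSeq π i ≠ extendSeq π j) ∧
      (∀ i < n, 1 ≤ extendSeq π i ∧ extendSeq π i ≤ n) ∧
      ∀ i j k, i < j → j < k → k < n →
        ¬(extendSeq π i < extendSeq π k ∧ extendSeq π k < extendSeq π j) := by
  rw [mem_perms132]
  constructor
  · rintro ⟨⟨h1, h2⟩, h3⟩
    refine ⟨fun i j hij hj h => ?_, fun i hi => ?_, fun i j k hij hjk hk => ?_⟩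
    · rw [extendSeq_of_lt π (hij.trans hj), extendSeq_of_lt π hj] at h
      have := congrArg Fin.val (h1 h)
      exact hij.ne this
    · rw [extendSeq_of_lt π hi]
      exact h2 _
    · rw [extendSeq_of_lt π hk, extendSeq_of_lt π (hjk.trans hk),
        extendSeq_of_lt π (hij.trans (hjk.trans hk))]
      exact h3 _ _ _ hij hjk
  · rintro ⟨h1, h2, h3⟩
    refine ⟨⟨fun i j h => ?_, fun i => ?_⟩, fun i j k hij hjk => ?_⟩
    · rcases lt_trichotomy i j with hij | hij | hij
      · exact absurd (by simpa using h) (h1 i j hij j.isLt)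
      · exact hij
      · exact absurd (by simpa using h.symm) (h1 j i hij i.isLt)
    · simpa using h2 i i.isLt
    · simpa using h3 i j k hij hjk k.isLt

/-- The permutation of length `n + 1` with maximum at position `a`, left of it a copy of `L`
shifted above the entries of `r`, and right of it `r`. -/
def gluePerm (n a : ℕ) (L : Fin a → ℤ) (r : Fin (n - a) → ℤ) : Fin (n + 1) → ℤ :=
  fun i => if (i : ℕ) < a then extendSeq L i + ((n : ℤ) - a)
    else if (i : ℕ) = a then (n : ℤ) + 1 else extendSeq r (i - a - 1)

section Glue

variable {n a : ℕ} (L : Fin a → ℤ) (r : Fin (n - a) → ℤ)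

theorem extendSeq_gluePerm_left (ha : a ≤ n) {i : ℕ} (hi : i < a) :
    extendSeq (gluePerm n a L r) i = extendSeq L i + ((n : ℤ) - a) := by
  rw [extendSeq_of_lt _ (by omega : i < n + 1)]
  exact if_pos hi

theorem extendSeq_gluePerm_max (ha : a ≤ n) :
    extendSeq (gluePerm n a L r) a = (n : ℤ) + 1 := by
  rw [extendSeq_of_lt _ (by omega : a < n + 1)]
  simp [gluePerm]

theorem extendSeq_gluePerm_right (ha : a ≤ n) {j : ℕ} (hj : j < n - a) :
    extendSeq (gluePerm n a L r) (a + 1 + j) = extendSeq r j := by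
  rw [extendSeq_of_lt _ (by omega : a + 1 + j < n + 1)]
  simp only [gluePerm]
  rw [if_neg (by omega), if_neg (by omega)]
  congr 1
  omega

end Glue

theorem isGluing_gluePerm {n a : ℕ} (ha : a ≤ n) {L : Fin a → ℤ} {r : Fin (n - a) → ℤ}
    (hL : L ∈ perms132 a) (hr : r ∈ perms132 (n - a)) :
    IsGluing a (n - a) ((n : ℤ) - a) (extendSeq L) (extendSeq r)
      (extendSeq (gluePerm n a L r)) := by
  obtain ⟨-, hL, -⟩ := mem_perms132_iff_extendSeq.1 hL
  obtain ⟨-, hr, -⟩ := mem_perms132_iff_extendSeq.1 hr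
  refine ⟨fun i hi => extendSeq_gluePerm_left L r ha hi,
    fun j hj => extendSeq_gluePerm_right L r ha hj, fun i hi => ?_, fun j hj => ?_,
    fun i hi j hj => ?_⟩
  · rw [extendSeq_gluePerm_left L r ha hi, extendSeq_gluePerm_max L r ha]
    have := hL i hi
    omega
  · rw [extendSeq_gluePerm_right L r ha hj, extendSeq_gluePerm_max L r ha]
    have := hr j hj
    omega
  · rw [extendSeq_gluePerm_right L r ha hj, extendSeq_gluePerm_left L r ha hi]
    have := hr j hj
    have := hL i hi
    omega

theorem lt_or_eq_or_exists_add {n i : ℕ} (a : ℕ) (hi : i < n + 1) :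
    i < a ∨ i = a ∨ ∃ j < n - a, i = a + 1 + j := by
  rcases lt_trichotomy i a with h | h | h
  · exact Or.inl h
  · exact Or.inr (Or.inl h)
  · exact Or.inr (Or.inr ⟨i - a - 1, by omega, by omega⟩)

theorem gluePerm_mem {n a : ℕ} (ha : a ≤ n) {L : Fin a → ℤ} {r : Fin (n - a) → ℤ}
    (hL : L ∈ perms132 a) (hr : r ∈ perms132 (n - a)) :
    gluePerm n a L r ∈ perms132 (n + 1) := by
  have hG := isGluing_gluePerm ha hL hr
  have hmax := extendSeq_gluePerm_max L r ha
  obtain ⟨hL1, hL2, hL3⟩ := mem_perms132_iff_extendSeq.1 hL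
  obtain ⟨hr1, hr2, hr3⟩ := mem_perms132_iff_extendSeq.1 hr
  rw [mem_perms132_iff_extendSeq]
  generalize extendSeq (gluePerm n a L r) = W at hG hmax
  obtain ⟨g1, g2, g3, g4, g5⟩ := hG
  refine ⟨fun i j hij hj => ?_, fun i hi => ?_, fun i j k hij hjk hk => ?_⟩
  · obtain hj | rfl | ⟨j, hj', rfl⟩ := lt_or_eq_or_exists_add a hj
    · have := hL1 i j hij hj
      rw [g1 i (by omega), g1 j hj]
      omega
    · exact (g3 i hij).ne
    · rcases lt_or_eq_or_exists_add a (by omega : i < n + 1) with hi | rfl | ⟨i, hi, rfl⟩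
      · exact (g5 i hi j hj').ne'
      · exact (g4 j hj').ne'
      · rw [g2 i (by omega), g2 j hj']
        exact hr1 i j (by omega) hj'
  · rcases lt_or_eq_or_exists_add a hi with hi | rfl | ⟨j, hj, rfl⟩
    · have := hL2 i hi
      rw [g1 i hi]
      push_cast
      omega
    · rw [hmax]
      push_cast
      omega
    · have := hr2 j hj
      rw [g2 j hj]
      push_cast
      omega
  · rintro ⟨h1, h2⟩
    obtain hk | rfl | ⟨k, hk', rfl⟩ := lt_or_eq_or_exists_add a hk
    · rw [g1 i (by omega), g1 k hk] at h1
      rw [g1 k hk, g1 j (by omega)] at h2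
      exact hL3 i j k hij hjk hk ⟨by omega, by omega⟩
    · exact lt_asymm h2 (g3 j hjk)
    · rcases lt_or_eq_or_exists_add a (by omega : i < n + 1) with hi | rfl | ⟨i, hi, rfl⟩
      · exact lt_asymm h1 (g5 i hi k hk')
      · exact lt_asymm h1 (g4 k hk')
      · obtain ⟨j, rfl⟩ : ∃ j', j = a + 1 + j' := ⟨j - a - 1, by omega⟩
        rw [g2 i hi, g2 k hk'] at h1
        rw [g2 k hk', g2 j (by omega)] at h2
        exact hr3 i j k (by omega) (by omega) hk' ⟨h1, h2⟩

theorem gluePerm_injective {n a b : ℕ} (ha : a ≤ n) (hb : b ≤ n)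
    {L : Fin a → ℤ} {r : Fin (n - a) → ℤ} {L' : Fin b → ℤ} {r' : Fin (n - b) → ℤ}
    (hL' : L' ∈ perms132 b) (hr' : r' ∈ perms132 (n - b))
    (h : gluePerm n a L r = gluePerm n b L' r') :
    (⟨a, L, r⟩ : (a : ℕ) × (Fin a → ℤ) × (Fin (n - a) → ℤ)) = ⟨b, L', r'⟩ := by
  have hG := isGluing_gluePerm hb hL' hr'
  have hab : a = b := by
    have h1 := extendSeq_gluePerm_max L r ha
    have h2 := extendSeq_gluePerm_max L' r' hb
    rw [h] at h1
    rcases lt_or_eq_or_exists_add b (by omega : a < n + 1) with h | h | ⟨j, hj, rfl⟩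
    · exact absurd (h1.trans h2.symm) (hG.left_lt a h).ne
    · exact h
    · exact absurd (h1.trans h2.symm) (hG.right_lt j hj).ne
  subst hab
  have hLL : L = L' := eq_of_extendSeq_eq fun i hi => by
    have h1 := extendSeq_gluePerm_left L r ha hi
    rw [h, extendSeq_gluePerm_left L' r' ha hi] at h1
    omega
  have hrr : r = r' := eq_of_extendSeq_eq fun i hi => by
    rw [← extendSeq_gluePerm_right L r ha hi, h, extendSeq_gluePerm_right L' r' ha hi]
  rw [hLL, hrr]

theorem IsPermSeq.exists_eq {n : ℕ} {π : Fin n → ℤ} (h : IsPermSeq n π) {v : ℤ}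
    (hv : 1 ≤ v) (hv' : v ≤ n) : ∃ i, π i = v := by
  have hsub : Finset.univ.image π ⊆ Finset.Icc (1 : ℤ) n := by
    intro x hx
    obtain ⟨i, -, rfl⟩ := Finset.mem_image.1 hx
    exact Finset.mem_Icc.2 (h.2 i)
  have heq := Finset.eq_of_subset_of_card_le hsub (by
    rw [Finset.card_image_of_injective _ h.1]; simp)
  have hmem : v ∈ Finset.univ.image π := heq ▸ Finset.mem_Icc.2 ⟨hv, hv'⟩
  simpa using hmem

theorem exists_gluePerm_eq {n : ℕ} {π : Fin (n + 1) → ℤ} (hπ : π ∈ perms132 (n + 1)) :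
    ∃ a ≤ n, ∃ L ∈ perms132 a, ∃ r ∈ perms132 (n - a), gluePerm n a L r = π := by
  obtain ⟨⟨a, ha⟩, hmax⟩ := (mem_perms132.1 hπ).1.exists_eq (v := (n : ℤ) + 1)
    (by omega) (by push_cast; omega)
  rw [← extendSeq_of_lt π ha] at hmax
  obtain ⟨h1, h2, h3⟩ := mem_perms132_iff_extendSeq.1 hπ
  have hinj : ∀ i j, i < n + 1 → j < n + 1 → extendSeq π i = extendSeq π j → i = j := by
    intro i j hi hj hij
    rcases lt_trichotomy i j with h | h | h
    · exact absurd hij (h1 i j h hj)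
    · exact h
    · exact absurd hij.symm (h1 j i h hi)
  have hlt : ∀ i < n + 1, i ≠ a → extendSeq π i ≤ n := by
    intro i hi hia
    have := (h2 i hi).2
    have hne : extendSeq π i ≠ n + 1 := fun h => hia (hinj i a hi ha (h.trans hmax.symm))
    push_cast at this
    omega
  have hLR : ∀ i < a, ∀ j < n - a, extendSeq π (a + 1 + j) < extendSeq π i := by
    intro i hi j hj
    have e1 := h3 i a (a + 1 + j) hi (by omega) (by omega)
    have e2 := h1 i (a + 1 + j) (by omega) (by omega)
    have e3 := hlt (a + 1 + j) (by omega) (by omega)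
    rw [hmax] at e1
    omega
  have hlow : ∀ i < a, ((n : ℤ) - a) + 1 ≤ extendSeq π i := by
    intro i hi
    have hc : (Finset.range (n - a)).card ≤ (Finset.Ico 1 (extendSeq π i)).card := by
      refine Finset.card_le_card_of_injOn (fun j => extendSeq π (a + 1 + j)) ?_ ?_
      · intro j hj
        have hj := Finset.mem_range.1 hj
        exact Finset.mem_coe.2 (Finset.mem_Ico.2 ⟨(h2 _ (by omega)).1, hLR i hi j hj⟩)
      · intro j hj k hk hjk
        have hj := Finset.mem_range.1 hj
        have hk := Finset.mem_range.1 hk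
        have := hinj _ _ (by omega) (by omega) hjk
        omega
    have := (h2 i (by omega)).1
    rw [Finset.card_range, Int.card_Ico] at hc
    omega
  have hhigh : ∀ j < n - a, extendSeq π (a + 1 + j) ≤ (n : ℤ) - a := by
    intro j hj
    have hc : (Finset.range a).card ≤ (Finset.Ioc (extendSeq π (a + 1 + j)) n).card := by
      refine Finset.card_le_card_of_injOn (fun i => extendSeq π i) ?_ ?_
      · intro i hi
        have hi := Finset.mem_range.1 hi
        exact Finset.mem_coe.2 (Finset.mem_Ioc.2 ⟨hLR i hi j hj, hlt i (by omega) (by omega)⟩)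
      · intro i hi k hk hik
        have hi := Finset.mem_range.1 hi
        have hk := Finset.mem_range.1 hk
        exact hinj _ _ (by omega) (by omega) hik
    have := hlt (a + 1 + j) (by omega) (by omega)
    rw [Finset.card_range, Int.card_Ioc] at hc
    omega
  have ha' : a ≤ n := by omega
  let L : Fin a → ℤ := fun i => extendSeq π i - ((n : ℤ) - a)
  let r : Fin (n - a) → ℤ := fun j => extendSeq π (a + 1 + j)
  have eL : ∀ i < a, extendSeq L i = extendSeq π i - ((n : ℤ) - a) :=
    fun i hi => extendSeq_of_lt L hi
  have er : ∀ j < n - a, extendSeq r j = extendSeq π (a + 1 + j) :=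
    fun j hj => extendSeq_of_lt r hj
  refine ⟨a, ha', L, mem_perms132_iff_extendSeq.2 ⟨?_, ?_, ?_⟩, r,
    mem_perms132_iff_extendSeq.2 ⟨?_, ?_, ?_⟩, eq_of_extendSeq_eq fun i hi => ?_⟩
  · intro i j hij hj
    rw [eL i (by omega), eL j hj]
    have := h1 i j hij (by omega)
    omega
  · intro i hi
    rw [eL i hi]
    have e1 := hlow i hi
    have e2 := hlt i (by omega) (by omega)
    omega
  · intro i j k hij hjk hk
    rw [eL i (by omega), eL j (by omega), eL k hk]
    have := h3 i j k hij hjk (by omega)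
    omega
  · intro i j hij hj
    rw [er i (by omega), er j hj]
    exact h1 _ _ (by omega) (by omega)
  · intro j hj
    rw [er j hj]
    have e1 := hhigh j hj
    have e2 := (h2 (a + 1 + j) (by omega)).1
    omega
  · intro i j k hij hjk hk
    rw [er i (by omega), er j (by omega), er k hk]
    exact h3 _ _ _ (by omega) (by omega) (by omega)
  · rcases lt_or_eq_or_exists_add a hi with hi | rfl | ⟨j, hj, rfl⟩
    · rw [extendSeq_gluePerm_left L r ha' hi, eL i hi]
      ring
    · rw [extendSeq_gluePerm_max L r ha', hmax]
    · rw [extendSeq_gluePerm_right L r ha' hj, er j hj]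

/-- The monomial `x ^ e₂(w) * y ^ e₃(w)`. -/
noncomputable def statWeight {m : ℕ} (w : Fin m → ℤ) : MvPolynomial (Fin 2) ℤ :=
  MvPolynomial.X 0 ^ eStat 2 w * MvPolynomial.X 1 ^ eStat 3 w

/-- The substitution `x ↦ x * y`, `y ↦ y`. -/
noncomputable def substXY : MvPolynomial (Fin 2) ℤ →ₐ[ℤ] MvPolynomial (Fin 2) ℤ :=
  MvPolynomial.bind₁ fun i : Fin 2 =>
    if i = 0 then MvPolynomial.X 0 * MvPolynomial.X 1 else MvPolynomial.X 1

theorem coeff_statWeight {m : ℕ} (w : Fin m → ℤ) (s : Fin 2 →₀ ℕ) :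
    MvPolynomial.coeff s (statWeight w) =
      if eStat 2 w = s 0 ∧ eStat 3 w = s 1 then 1 else 0 := by
  classical
  rw [statWeight, MvPolynomial.X_pow_eq_monomial, MvPolynomial.X_pow_eq_monomial,
    MvPolynomial.monomial_mul, MvPolynomial.coeff_monomial, mul_one]
  congr 1
  rw [Finsupp.ext_iff]
  simp

theorem statWeight_gluePerm {n a : ℕ} (ha : a ≤ n) {L : Fin a → ℤ} {r : Fin (n - a) → ℤ}
    (hL : L ∈ perms132 a) (hr : r ∈ perms132 (n - a)) :
    statWeight (gluePerm n a L r) =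
      MvPolynomial.X 0 ^ (if 1 ≤ a then 1 else 0) * (substXY (statWeight L) * statWeight r) := by
  have hG := isGluing_gluePerm ha hL hr
  have h2 := hG.ascCount_eq
  have h3 := hG.ascThenCount_eq
  rw [show a + 1 + (n - a) = n + 1 by omega, ← eStat_two, ← eStat_two, ← eStat_two] at h2
  rw [show a + 1 + (n - a) = n + 1 by omega, ← eStat_three, ← eStat_three, ← eStat_three,
    ← eStat_two] at h3
  simp only [statWeight, h2, h3, substXY, map_mul, map_pow, MvPolynomial.bind₁_X_right]
  simp only [if_true, one_ne_zero, if_false]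
  ring

/-- The generating polynomial of `(e₂, e₃)` over the permutations of length `n` avoiding 1-3-2. -/
noncomputable def statPoly (n : ℕ) : MvPolynomial (Fin 2) ℤ :=
  ∑ π ∈ perms132 n, statWeight π

theorem coeff_statPoly (n : ℕ) (s : Fin 2 →₀ ℕ) :
    MvPolynomial.coeff s (statPoly n) =
      (Nat.card {π : Fin n → ℤ // IsPermSeq n π ∧ Avoids132 π ∧
        eStat 2 π = s 0 ∧ eStat 3 π = s 1} : ℤ) := by
  classical
  rw [statPoly, MvPolynomial.coeff_sum]
  simp only [coeff_statWeight]
  rw [Finset.sum_boole, ← Nat.card_eq_finsetCard]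
  congr 1
  refine Nat.card_congr (Equiv.subtypeEquivRight fun π => ?_)
  rw [Finset.mem_filter, mem_perms132, and_assoc]

theorem statPoly_zero : statPoly 0 = 1 := by
  have hmem : (perms132 0) = {Fin.elim0} := by
    ext π
    simp only [Finset.mem_singleton, Subsingleton.elim π Fin.elim0, iff_true]
    rw [mem_perms132_iff_extendSeq]
    refine ⟨?_, ?_, ?_⟩ <;> intros <;> omega
  simp [statPoly, hmem, statWeight, eStat_two, eStat_three, ascCount, ascThenCount]

theorem statPoly_succ_eq_sum (n : ℕ) :
    statPoly (n + 1) = ∑ a ∈ Finset.range (n + 1),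
      MvPolynomial.X 0 ^ (if 1 ≤ a then 1 else 0) *
        (substXY (statPoly a) * statPoly (n - a)) := by
  have hsum : ∀ a, MvPolynomial.X 0 ^ (if 1 ≤ a then 1 else 0) *
      (substXY (statPoly a) * statPoly (n - a)) =
      ∑ p ∈ perms132 a ×ˢ perms132 (n - a), MvPolynomial.X 0 ^ (if 1 ≤ a then 1 else 0) *
        (substXY (statWeight p.1) * statWeight p.2) := by
    intro a
    rw [← Finset.mul_sum, statPoly, statPoly, map_sum, Finset.sum_mul_sum, Finset.sum_product]
  simp only [hsum]
  rw [Finset.sum_sigma', statPoly]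
  symm
  refine Finset.sum_bij (fun p _ => gluePerm n p.1 p.2.1 p.2.2) ?_ ?_ ?_ ?_
  · rintro ⟨a, L, r⟩ h
    simp only [Finset.mem_sigma, Finset.mem_range, Finset.mem_product] at h
    exact gluePerm_mem (Nat.lt_succ_iff.1 h.1) h.2.1 h.2.2
  · rintro ⟨a, L, r⟩ h ⟨b, L', r'⟩ h' heq
    simp only [Finset.mem_sigma, Finset.mem_range, Finset.mem_product] at h h'
    exact gluePerm_injective (Nat.lt_succ_iff.1 h.1) (Nat.lt_succ_iff.1 h'.1) h'.2.1 h'.2.2 heq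
  · intro π hπ
    obtain ⟨a, ha, L, hL, r, hr, h⟩ := exists_gluePerm_eq hπ
    refine ⟨⟨a, L, r⟩, ?_, h⟩
    simp only [Finset.mem_sigma, Finset.mem_range, Finset.mem_product]
    exact ⟨by omega, hL, hr⟩
  · rintro ⟨a, L, r⟩ h
    simp only [Finset.mem_sigma, Finset.mem_range, Finset.mem_product] at h
    exact (statWeight_gluePerm (Nat.lt_succ_iff.1 h.1) h.2.1 h.2.2).symm

theorem statPoly_succ (n : ℕ) :
    statPoly (n + 1) = statPoly n + MvPolynomial.X 0 *
      ∑ a ∈ Finset.Icc 1 n, substXY (statPoly a) * statPoly (n - a) := by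
  rw [statPoly_succ_eq_sum, Finset.range_eq_Ico,
    Finset.sum_eq_sum_Ico_succ_bot (Nat.succ_pos n), Finset.mul_sum]
  congr 1
  · simp [statPoly_zero]
  · refine Finset.sum_congr rfl fun a ha => ?_
    rw [if_pos (Finset.mem_Icc.1 ha).1, pow_one]

/-- The bivariate polynomials
`R_n(x,y) = Σ_{π ∈ S_n(1-3-2)} x^{e_2(π)} y^{e_3(π)}` (with `x = X 0`,
`y = X 1`) satisfy `R_{n+1}(x,y) = R_n(x,y) + x · Σ_{a+b=n, a≥1} R_a(xy,y)·R_b(x,y)`. -/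
theorem e2_e3_polynomial_recurrence (R : ℕ → MvPolynomial (Fin 2) ℤ)
    (hR : ∀ n, ∀ s : Fin 2 →₀ ℕ, MvPolynomial.coeff s (R n) =
      (Nat.card {π : Fin n → ℤ // IsPermSeq n π ∧ Avoids132 π ∧
        eStat 2 π = s 0 ∧ eStat 3 π = s 1} : ℤ)) :
    ∀ n, R (n + 1) =
      R n + MvPolynomial.X 0 *
        ∑ a ∈ Finset.Icc 1 n,
          (MvPolynomial.bind₁ (fun i : Fin 2 =>
              if i = 0 then MvPolynomial.X 0 * MvPolynomial.X 1
              else MvPolynomial.X 1) (R a)) * R (n - a) := by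
  obtain rfl : R = statPoly :=
    funext fun n => MvPolynomial.ext _ _ fun s => by rw [hR, coeff_statPoly]
  exact statPoly_succ
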